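/- Under the stochastic balancing setup, assume additionally that the events A_m = \{ b_1(m) \ge \tau \}, m \ge n_{opt}+1, are mutually independent. Then for every n \ge n_{opt}+2: \mathbb{P}\big( n_*(\tau) = n \big) \le \big( 2\sqrt{2}\, \exp(-\tau^2/4) \big)^{\,n - n_{opt} - 1}. -/

import Mathlib

open MeasureTheory ProbabilityTheory

/-- Errors that contract and fall below the noise level at `k` stay below it afterwards. -/
theorem norm_sub_le_noise_of_le {H : Type*} [NormedAddCommGroup H] {x : H} {xs : ℕ → H}
    {ρ : ℕ → ℝ} {w : ℝ} (hw : w < 1) (hdec : ∀ n, ‖x - xs (n + 1)‖ ≤ w * ‖x - xs n‖)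
    (hρ : ∀ n, ρ n ≤ ρ (n + 1)) {k : ℕ} (hk : ‖x - xs k‖ ≤ ρ k) {m : ℕ} (hm : k ≤ m) :
    ‖x - xs m‖ ≤ ρ m := by
  induction m, hm using Nat.le_induction with
  | base => exact hk
  | succ m _ ih =>
    have hle := mul_le_of_le_one_left (norm_nonneg (x - xs m)) hw.le
    linarith [hdec m, hρ m]

/-- The tail constant of the union bound is at least `1` for thresholds below `1`. -/
theorem one_le_two_mul_sqrt_two_mul_exp {τ : ℝ} (h0 : 0 ≤ τ) (h1 : τ ≤ 1) :
    1 ≤ 2 * Real.sqrt 2 * Real.exp (-τ ^ 2 / 4) := by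
  have hs : 1 ≤ Real.sqrt 2 := Real.one_le_sqrt.mpr (by norm_num)
  have he : 1 / 2 ≤ Real.exp (-τ ^ 2 / 4) := by
    nlinarith [Real.add_one_le_exp (-τ ^ 2 / 4)]
  nlinarith

/-- If two noise-free points are within `r` of `x`, then noisy copies of them at distance at least
`4 * τ * r` with `1 ≤ τ` have a noise term of norm at least `τ * r`. -/
theorem noise_large_of_noisy_dist_large {H : Type*} [NormedAddCommGroup H] {x a b u v : H}
    {τ r : ℝ} (hr : 0 ≤ r) (hτ : 1 ≤ τ) (ha : ‖x - a‖ ≤ r) (hb : ‖x - b‖ ≤ r)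
    (h : 4 * τ * r ≤ ‖(a + u) - (b + v)‖) : τ * r ≤ ‖u‖ ∨ τ * r ≤ ‖v‖ := by
  by_contra! hc
  have hab : ‖(a + u) - (b + v)‖ ≤ ‖x - b‖ + ‖x - a‖ + (‖u‖ + ‖v‖) := by
    calc ‖(a + u) - (b + v)‖ = ‖((x - b) - (x - a)) + (u - v)‖ := by congr 1; abel
      _ ≤ ‖(x - b) - (x - a)‖ + ‖u - v‖ := norm_add_le _ _
      _ ≤ _ := add_le_add (norm_sub_le _ _) (norm_sub_le _ _)
  nlinarith [hc.1, hc.2]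

/-- Independence bounds the probability of a finite intersection by a power of a uniform bound. -/
theorem ProbabilityTheory.iIndepSet.measure_biInter_le_pow {Ω ι : Type*} [MeasurableSpace Ω]
    {P : Measure Ω} {A : ι → Set Ω} (h : iIndepSet A P) {c : ENNReal} (s : Finset ι)
    (hc : ∀ i ∈ s, P (A i) ≤ c) : P (⋂ i ∈ s, A i) ≤ c ^ s.card :=
  (h.meas_biInter s).trans_le (Finset.prod_le_pow_card s _ c hc)

open MeasureTheory ProbabilityTheory

/-- In the stochastic balancing setup, if the events
`A_m = {b₁(m) ≥ τ}`, `m ≥ n_opt + 1`, are mutually independent, then for every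
`n ≥ n_opt + 2` one has `ℙ(n_*(τ) = n) ≤ (2√2 exp(-τ²/4))^(n - n_opt - 1)`. -/
theorem fast_balancing_late_stop_bound_independent
    {H : Type*} [NormedAddCommGroup H] [InnerProductSpace ℝ H] [CompleteSpace H]
    [MeasurableSpace H] [BorelSpace H]
    {Ω : Type*} [MeasurableSpace Ω] (P : Measure Ω) [IsProbabilityMeasure P]
    (x : H) (xs : ℕ → H) (η : ℕ → Ω → H) (ρ : ℕ → ℝ) (hρpos : ∀ n, 0 < ρ n)
    (w1 w2 : ℝ) (hw10 : 0 < w1) (hw11 : w1 < 1) (hw2 : 1 < w2)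
    (hdec : ∀ n, ‖x - xs (n + 1)‖ ≤ w1 * ‖x - xs n‖)
    (hρmono : ∀ n, ρ n ≤ ρ (n + 1)) (hρgrow : ∀ n, ρ (n + 1) ≤ w2 * ρ n)
    (nopt : ℕ)
    (hopt1 : ρ nopt < ‖xs nopt - x‖)
    (hopt2 : ‖xs (nopt + 1) - x‖ ≤ ρ (nopt + 1))
    (hηmeas : ∀ n, Measurable (η n))
    (htail : ∀ n, ∀ t : ℝ, 0 < t →
      P {ω | t * ρ n ≤ ‖η n ω‖} ≤
        ENNReal.ofReal (Real.sqrt 2 * Real.exp (-t ^ 2 / 4)))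
    (τ : ℝ) (hτ : 0 ≤ τ)
    (A : ℕ → Set Ω)
    (hA : ∀ m, A m =
      {ω | 4 * τ * ρ (m + 1) ≤ ‖(xs m + η m ω) - (xs (m + 1) + η (m + 1) ω)‖})
    (hindep : iIndepSet (fun m : {m : ℕ // nopt + 1 ≤ m} => A m) P)
    (nstar : Ω → ℕ)
    (hstar : ∀ ω, IsLeast
      {n | ‖(xs n + η n ω) - (xs (n + 1) + η (n + 1) ω)‖ / (4 * ρ (n + 1)) < τ}
      (nstar ω)) :
    ∀ n, nopt + 2 ≤ n →
      P {ω | nstar ω = n} ≤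
        ENNReal.ofReal (2 * Real.sqrt 2 * Real.exp (-τ ^ 2 / 4)) ^ (n - nopt - 1) := by
  have herr : ∀ m, nopt + 1 ≤ m → ‖x - xs m‖ ≤ ρ m := fun m hm =>
    norm_sub_le_noise_of_le hw11 hdec hρmono (by rwa [norm_sub_rev]) hm
  have hbound : ∀ m, nopt + 1 ≤ m →
      P (A m) ≤ ENNReal.ofReal (2 * Real.sqrt 2 * Real.exp (-τ ^ 2 / 4)) := by
    intro m hm
    rcases le_total τ 1 with h1 | h1
    · exact prob_le_one.trans
        (ENNReal.one_le_ofReal.mpr (one_le_two_mul_sqrt_two_mul_exp hτ h1))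
    · have hsub : A m ⊆ {ω | τ * ρ m ≤ ‖η m ω‖} ∪ {ω | τ * ρ (m + 1) ≤ ‖η (m + 1) ω‖} := by
        rw [hA]
        intro ω hω
        exact (noise_large_of_noisy_dist_large (hρpos (m + 1)).le h1
          ((herr m hm).trans (hρmono m)) (herr (m + 1) (by omega)) hω).imp_left
          (mul_le_mul_of_nonneg_left (hρmono m) hτ).trans
      have hpos : 0 < τ := by linarith
      calc P (A m) ≤ _ := measure_mono hsub
        _ ≤ _ := measure_union_le _ _
        _ ≤ _ := add_le_add (htail m τ hpos) (htail (m + 1) τ hpos)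
        _ = _ := by
          rw [← ENNReal.ofReal_add (by positivity) (by positivity)]
          congr 1
          ring
  intro n _
  let s := (Finset.Ico (nopt + 1) n).subtype (nopt + 1 ≤ ·)
  have hcard : s.card = n - nopt - 1 := by
    rw [Finset.card_subtype, Finset.filter_true_of_mem fun m hm => (Finset.mem_Ico.mp hm).1,
      Nat.card_Ico, Nat.sub_sub]
  have hsub : {ω | nstar ω = n} ⊆ ⋂ m ∈ s, A m := by
    intro ω hω
    refine Set.mem_iInter₂.mpr fun m hm => ?_
    have hmn : (m : ℕ) < n := (Finset.mem_Ico.mp (Finset.mem_subtype.mp hm)).2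
    have hge : τ ≤ ‖(xs m + η m ω) - (xs (m + 1) + η (m + 1) ω)‖ / (4 * ρ (m + 1)) := by
      by_contra! hlt
      have hle : nstar ω ≤ m := (hstar ω).2 hlt
      rw [Set.mem_ofPred_eq] at hω
      omega
    rw [le_div_iff₀ (mul_pos four_pos (hρpos _))] at hge
    rw [hA, Set.mem_ofPred_eq]
    linarith
  rw [← hcard]
  exact (measure_mono hsub).trans
    (hindep.measure_biInter_le_pow s fun m _ => hbound m m.2)
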